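/- For every integer d ≥ 2 there exists a subset S ⊆ G_d such that p(S) is a vertex of the White Whale H_∞^+(d,1) whose degree is at least 2^d/(d+1); in particular, the White Whale has a vertex whose degree is exponential in the dimension d (for example S = U_d^{⌊d/2⌋}, whose vertex has degree C(d, ⌊d/2⌋) ≥ 2^d/(d+1)). -/

import Mathlib

/-- The set `G_d` of generators of the White Whale:
all nonzero 0/1-valued vectors of `ℝ^d`. -/
def whaleGens (d : ℕ) : Set (Fin d → ℝ) :=
  {g | g ≠ 0 ∧ ∀ i, g i = 0 ∨ g i = 1}

/-- The point `p(S)`: the sum of the vectors in `S` (with `p(∅) = 0`). -/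
noncomputable def whaleSum {d : ℕ} (S : Set (Fin d → ℝ)) : Fin d → ℝ :=
  ∑ᶠ g ∈ S, g

/-- The White Whale `H_∞^+(d,1)`: the convex hull of the points `p(S)`
over all subsets `S ⊆ G_d`. -/
noncomputable def whiteWhale (d : ℕ) : Set (Fin d → ℝ) :=
  convexHull ℝ {x | ∃ S : Set (Fin d → ℝ), S ⊆ whaleGens d ∧ x = whaleSum S}

/-- A vertex of the White Whale is an extreme point of it. -/
def IsWhaleVertex (d : ℕ) (x : Fin d → ℝ) : Prop :=
  x ∈ Set.extremePoints ℝ (whiteWhale d)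

/-- The indicator vector of a set of coordinates. -/
noncomputable def indicatorVec {d : ℕ} (T : Finset (Fin d)) : Fin d → ℝ :=
  fun i => if i ∈ T then 1 else 0

lemma indicatorVec_injective {d : ℕ} :
    Function.Injective (indicatorVec : Finset (Fin d) → Fin d → ℝ) := by
  intro A B h
  ext i
  have hi := congrFun h i
  by_cases hA : i ∈ A <;> by_cases hB : i ∈ B <;> simp_all [indicatorVec]

lemma indicatorVec_mem_whaleGens {d : ℕ} {T : Finset (Fin d)} (hT : T.Nonempty) :
    indicatorVec T ∈ whaleGens d := by
  obtain ⟨i, hi⟩ := hT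
  refine ⟨fun h => ?_, fun j => ?_⟩
  · simpa [indicatorVec, hi] using congrFun h i
  · by_cases hj : j ∈ T <;> simp [indicatorVec, hj]

lemma exists_indicatorVec_eq {d : ℕ} {g : Fin d → ℝ} (hg : g ∈ whaleGens d) :
    ∃ T : Finset (Fin d), T.Nonempty ∧ indicatorVec T = g := by
  classical
  obtain ⟨h0, h⟩ := hg
  have hT : indicatorVec (Finset.univ.filter fun i => g i = 1) = g := by
    funext i
    rcases h i with hi | hi <;> simp [indicatorVec, hi]
  refine ⟨_, ?_, hT⟩
  rw [Finset.nonempty_iff_ne_empty]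
  intro he
  rw [he] at hT
  apply h0
  rw [← hT]
  funext i
  simp [indicatorVec]

lemma whaleGens_finite (d : ℕ) : (whaleGens d).Finite :=
  (Set.finite_range (indicatorVec : Finset (Fin d) → Fin d → ℝ)).subset fun _ hg =>
    let ⟨T, _, hT⟩ := exists_indicatorVec_eq hg
    ⟨T, hT⟩

open Classical in
lemma map_whaleSum {d : ℕ} (f : (Fin d → ℝ) →ₗ[ℝ] ℝ) {S : Set (Fin d → ℝ)}
    (hS : S ⊆ whaleGens d) :
    f (whaleSum S) = ∑ g ∈ (whaleGens_finite d).toFinset, if g ∈ S then f g else 0 := by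
  have hfin : S.Finite := (whaleGens_finite d).subset hS
  rw [whaleSum, finsum_mem_eq_finite_toFinset_sum _ hfin, map_sum, ← Finset.sum_filter]
  congr 1
  ext g
  simpa using fun h => hS h

/-- A subset of the generators cut out by the sign of a linear functional gives a vertex. -/
lemma isWhaleVertex_of_separating {d : ℕ} (f : (Fin d → ℝ) →ₗ[ℝ] ℝ) {S : Set (Fin d → ℝ)}
    (hS : S ⊆ whaleGens d) (hpos : ∀ g ∈ S, 0 < f g)
    (hneg : ∀ g ∈ whaleGens d, g ∉ S → f g < 0) : IsWhaleVertex d (whaleSum S) := by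
  classical
  have hmax : ∀ S' ⊆ whaleGens d, whaleSum S' = whaleSum S ∨
      f (whaleSum S') < f (whaleSum S) := by
    intro S' hS'
    by_cases hne : S' = S
    · exact Or.inl (by rw [hne])
    right
    rw [map_whaleSum f hS, map_whaleSum f hS']
    apply Finset.sum_lt_sum
    · intro g hg
      have hg' : g ∈ whaleGens d := by simpa using hg
      by_cases h1 : g ∈ S <;> by_cases h2 : g ∈ S' <;> simp only [h1, h2, if_true, if_false]
      · exact le_rfl
      · exact (hpos g h1).le
      · exact (hneg g hg' h1).le
      · exact le_rfl
    · obtain ⟨g, hg⟩ : ∃ g, ¬ (g ∈ S' ↔ g ∈ S) := by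
        by_contra! h
        exact hne (Set.ext h)
      by_cases h1 : g ∈ S
      · have h2 : g ∉ S' := fun h => hg ⟨fun _ => h1, fun _ => h⟩
        exact ⟨g, by simpa using hS h1, by simpa [h1, h2] using hpos g h1⟩
      · have h2 : g ∈ S' := by tauto
        exact ⟨g, by simpa using hS' h2, by simpa [h1, h2] using hneg g (hS' h2) h1⟩
  have hull : ∀ y ∈ whiteWhale d, y = whaleSum S ∨ f y < f (whaleSum S) := by
    have hconv : Convex ℝ {y | y = whaleSum S ∨ f y < f (whaleSum S)} := by
      intro x hx y hy a b ha hb hab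
      have hxle : f x ≤ f (whaleSum S) := hx.elim (fun h => by rw [h]) le_of_lt
      have hyle : f y ≤ f (whaleSum S) := hy.elim (fun h => by rw [h]) le_of_lt
      have hb' : b = 1 - a := by linarith
      subst hb'
      rcases ha.eq_or_lt with rfl | ha
      · simpa using hy
      rcases hb.eq_or_lt with hb | hb
      · have : a = 1 := by linarith
        subst this
        simpa using hx
      rcases hx with rfl | hx
      · rcases hy with rfl | hy
        · left
          rw [← add_smul]
          simp
        · right
          simp only [map_add, map_smul, smul_eq_mul]
          nlinarith
      · right
        simp only [map_add, map_smul, smul_eq_mul]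
        nlinarith
    intro y hy
    refine convexHull_min ?_ hconv hy
    rintro _ ⟨S', hS', rfl⟩
    exact hmax S' hS'
  refine ⟨subset_convexHull ℝ _ ⟨S, hS, rfl⟩, ?_⟩
  rintro x hx y hy ⟨a, b, ha, hb, hab, hxy⟩
  have hyle : f y ≤ f (whaleSum S) := (hull y hy).elim (fun h => by rw [h]) le_of_lt
  refine (hull x hx).resolve_right fun hlt => ?_
  have hf : a * f x + b * f y = f (whaleSum S) := by
    rw [← hxy]
    simp
  have hb' : b = 1 - a := by linarith
  subst hb'
  nlinarith

/-- A family of coordinate sets cut out by the sign of a weighting gives a vertex. -/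
lemma isWhaleVertex_of_weights {d : ℕ} (c : Fin d → ℝ) {F : Set (Finset (Fin d))}
    (hpos : ∀ T ∈ F, 0 < ∑ i ∈ T, c i)
    (hneg : ∀ T : Finset (Fin d), T.Nonempty → T ∉ F → ∑ i ∈ T, c i < 0) :
    IsWhaleVertex d (whaleSum (indicatorVec '' F)) := by
  let f : (Fin d → ℝ) →ₗ[ℝ] ℝ := ∑ i, c i • LinearMap.proj i
  have hf : ∀ T, f (indicatorVec T) = ∑ i ∈ T, c i := by
    intro T
    simp [f, indicatorVec, Finset.sum_ite_mem]
  apply isWhaleVertex_of_separating f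
  · rintro _ ⟨T, hT, rfl⟩
    apply indicatorVec_mem_whaleGens
    rw [Finset.nonempty_iff_ne_empty]
    rintro rfl
    simpa using hpos _ hT
  · rintro _ ⟨T, hT, rfl⟩
    rw [hf]
    exact hpos T hT
  · intro g hg hgF
    obtain ⟨T, hT, rfl⟩ := exists_indicatorVec_eq hg
    rw [hf]
    exact hneg T hT fun h => hgF ⟨T, h, rfl⟩

/-- The family of sets of at most `k` coordinates containing the coordinate `l`. -/
def smallSetsThrough {d : ℕ} (l : Fin d) (k : ℕ) : Set (Finset (Fin d)) :=
  {T | l ∈ T ∧ T.card ≤ k}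

lemma sum_weights {d : ℕ} (l : Fin d) (T₀ T : Finset (Fin d)) (t a b : ℝ) :
    ∑ i ∈ T, ((if i = l then t else 0) - a + (if i ∈ T₀ then b else 0)) =
      (if l ∈ T then t else 0) - T.card * a + (T ∩ T₀).card * b := by
  rw [Finset.sum_add_distrib, Finset.sum_sub_distrib, Finset.sum_ite_eq', Finset.sum_ite_mem]
  simp

lemma card_inter_lt_of_ne {α : Type*} [DecidableEq α] {T T₀ : Finset α} (hne : T ≠ T₀)
    (hcard : T.card ≤ T₀.card) : (T ∩ T₀).card + 1 ≤ T₀.card := by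
  refine Finset.card_lt_card (Finset.inter_subset_right.ssubset_of_ne fun h => hne ?_)
  exact (Finset.eq_of_subset_of_card_le (Finset.inter_eq_right.mp h) hcard).symm

lemma isWhaleVertex_smallSetsThrough {d : ℕ} (l : Fin d) (k : ℕ) :
    IsWhaleVertex d (whaleSum (indicatorVec '' smallSetsThrough l k)) := by
  apply isWhaleVertex_of_weights
    fun i => (if i = l then (k + 1 / 2 : ℝ) else 0) - 1 +
      (if i ∈ (∅ : Finset (Fin d)) then 0 else 0)
  · rintro T ⟨hl, hk⟩
    rw [sum_weights, if_pos hl]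
    have : (T.card : ℝ) ≤ k := mod_cast hk
    linarith
  · intro T hT hTF
    rw [sum_weights]
    split_ifs with hl
    · have : k + 1 ≤ T.card := by
        by_contra! h
        exact hTF ⟨hl, by omega⟩
      have : (k + 1 : ℝ) ≤ T.card := mod_cast this
      linarith
    · have : (1 : ℝ) ≤ T.card := mod_cast hT.card_pos
      linarith

lemma isWhaleVertex_smallSetsThrough_diff {d : ℕ} (l : Fin d) (k : ℕ) {T₀ : Finset (Fin d)}
    (hl₀ : l ∈ T₀) (hk₀ : T₀.card = k) :
    IsWhaleVertex d (whaleSum (indicatorVec '' (smallSetsThrough l k \ {T₀}))) := by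
  apply isWhaleVertex_of_weights
    fun i => (if i = l then (2 * (k + 2) * k + 2 * k - 1 : ℝ) else 0) - 2 * (k + 2) +
      (if i ∈ T₀ then -2 else 0)
  · rintro T ⟨⟨hl, hk⟩, hne⟩
    rw [sum_weights, if_pos hl]
    have hm := card_inter_lt_of_ne hne (hk.trans hk₀.ge)
    rw [hk₀] at hm
    have hm' : ((T ∩ T₀).card + 1 : ℝ) ≤ k := mod_cast hm
    have hk' : (T.card : ℝ) ≤ k := mod_cast hk
    nlinarith
  · intro T hT hTF
    rw [sum_weights]
    have hm0 : (0 : ℝ) ≤ (T ∩ T₀).card := Nat.cast_nonneg _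
    have hk0 : (0 : ℝ) ≤ k := Nat.cast_nonneg _
    split_ifs with hl
    · by_cases hne : T = T₀
      · subst hne
        rw [Finset.inter_self, hk₀]
        linarith
      · have : k + 1 ≤ T.card := by
          by_contra! h
          exact hTF ⟨⟨hl, by omega⟩, hne⟩
        have : (k + 1 : ℝ) ≤ T.card := mod_cast this
        nlinarith
    · have : (1 : ℝ) ≤ T.card := mod_cast hT.card_pos
      nlinarith

lemma isWhaleVertex_smallSetsThrough_union {d : ℕ} (l : Fin d) (k : ℕ) {T₀ : Finset (Fin d)}
    (hl₀ : l ∈ T₀) (hk₀ : T₀.card = k + 1) :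
    IsWhaleVertex d (whaleSum (indicatorVec '' (smallSetsThrough l k ∪ {T₀}))) := by
  apply isWhaleVertex_of_weights
    fun i => (if i = l then (2 * (k + 2) * (k + 1) - 2 * k - 1 : ℝ) else 0) - 2 * (k + 2) +
      (if i ∈ T₀ then 2 else 0)
  · intro T hT
    have hm0 : (0 : ℝ) ≤ (T ∩ T₀).card := Nat.cast_nonneg _
    rw [sum_weights]
    rcases hT with ⟨hl, hk⟩ | rfl
    · rw [if_pos hl]
      have hk' : (T.card : ℝ) ≤ k := mod_cast hk
      nlinarith
    · rw [if_pos hl₀, Finset.inter_self, hk₀]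
      push_cast
      linarith
  · intro T hT hTF
    rw [sum_weights]
    have hk0 : (0 : ℝ) ≤ k := Nat.cast_nonneg _
    have hmT : ((T ∩ T₀).card : ℝ) ≤ T.card :=
      mod_cast Finset.card_le_card Finset.inter_subset_left
    split_ifs with hl
    · have hne : T ≠ T₀ := fun h => hTF (Or.inr h)
      have hk : k + 1 ≤ T.card := by
        by_contra! h
        exact hTF (Or.inl ⟨hl, by omega⟩)
      rcases hk.eq_or_lt with hk | hk
      · have hm := card_inter_lt_of_ne hne (by omega)
        rw [hk₀] at hm
        have hm' : ((T ∩ T₀).card : ℝ) ≤ k := mod_cast (by omega)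
        rw [← hk]
        push_cast
        linarith
      · have hm : ((T ∩ T₀).card : ℝ) ≤ k + 1 := by
          rw [← Nat.cast_add_one, ← hk₀]
          exact mod_cast Finset.card_le_card Finset.inter_subset_right
        have : (k + 2 : ℝ) ≤ T.card := mod_cast hk
        nlinarith
    · have : (1 : ℝ) ≤ T.card := mod_cast hT.card_pos
      nlinarith

lemma two_pow_div_le_choose_half (d : ℕ) : (2 : ℝ) ^ d / (d + 1) ≤ (d.choose (d / 2) : ℝ) := by
  rw [div_le_iff₀ (by positivity)]
  have h : 2 ^ d ≤ d.choose (d / 2) * (d + 1) := by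
    rw [← Nat.sum_range_choose]
    refine (Finset.sum_le_card_nsmul _ _ _ fun i _ => Nat.choose_le_middle i d).trans ?_
    simp [mul_comm]
  exact mod_cast h

lemma insert_injOn_powersetCard {α : Type*} [DecidableEq α] [Fintype α] (l : α) (k : ℕ) :
    Set.InjOn (insert l) (Finset.powersetCard k (Finset.univ : Finset α) : Set (Finset α)) := by
  intro A hA B hB h
  have hA : A.card = k := by simpa using hA
  have hB : B.card = k := by simpa using hB
  have hcard := congrArg Finset.card h
  have herase := congrArg (fun T => T.erase l) h
  by_cases h1 : l ∈ A <;> by_cases h2 : l ∈ B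
  · simpa [h1, h2] using h
  · simp [h1, h2] at hcard
    omega
  · simp [h1, h2] at hcard
    omega
  · simpa [h1, h2] using herase

/-- The White Whale has a vertex of degree at least 2^d/(d+1): a vertex whose
degree is exponential in the dimension. -/
theorem whale_exists_high_degree_vertex (d : ℕ) (hd : 2 ≤ d) :
    ∃ S : Set (Fin d → ℝ), S ⊆ whaleGens d ∧ IsWhaleVertex d (whaleSum S) ∧
      (2 : ℝ) ^ d / (d + 1) ≤
        ({g | g ∈ whaleGens d ∧
          ((g ∈ S ∧ IsWhaleVertex d (whaleSum (S \ {g}))) ∨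
           (g ∉ S ∧ IsWhaleVertex d (whaleSum (S ∪ {g}))))}.ncard : ℝ) := by
  classical
  let l : Fin d := ⟨d - 1, by omega⟩
  let k := d / 2
  have hk : 1 ≤ k := by omega
  have hF : ∀ T ∈ smallSetsThrough l k, T.Nonempty := fun T hT => ⟨l, hT.1⟩
  refine ⟨indicatorVec '' smallSetsThrough l k, ?_, isWhaleVertex_smallSetsThrough l k, ?_⟩
  · rintro _ ⟨T, hT, rfl⟩
    exact indicatorVec_mem_whaleGens (hF T hT)
  refine (two_pow_div_le_choose_half d).trans ?_
  let N := (Finset.powersetCard k (Finset.univ : Finset (Fin d))).image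
    fun T => indicatorVec (insert l T)
  have hN : N.card = d.choose k := by
    rw [Finset.card_image_of_injOn, Finset.card_powersetCard, Finset.card_univ, Fintype.card_fin]
    exact indicatorVec_injective.comp_injOn (insert_injOn_powersetCard l k)
  rw [Nat.cast_le, ← hN, ← Set.ncard_coe_finset]
  refine Set.ncard_le_ncard ?_ ((whaleGens_finite d).subset fun g hg => hg.1)
  intro g hg
  obtain ⟨T, hT, rfl⟩ := Finset.mem_image.mp (Finset.mem_coe.mp hg)
  have hT : T.card = k := by simpa using hT
  have hl : l ∈ insert l T := Finset.mem_insert_self l T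
  refine ⟨indicatorVec_mem_whaleGens ⟨l, hl⟩, ?_⟩
  rw [indicatorVec_injective.mem_set_image, ← Set.image_singleton,
    ← Set.image_sdiff indicatorVec_injective, ← Set.image_union]
  by_cases hlT : l ∈ T
  · have hcard : (insert l T).card = k := by rw [Finset.insert_eq_of_mem hlT, hT]
    exact Or.inl ⟨⟨hl, hcard.le⟩, isWhaleVertex_smallSetsThrough_diff l k hl hcard⟩
  · have hcard : (insert l T).card = k + 1 := by rw [Finset.card_insert_of_notMem hlT, hT]
    exact Or.inr ⟨fun h => by have := h.2; omega,
      isWhaleVertex_smallSetsThrough_union l k hl hcard⟩
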